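/- arXiv:1803.09289 — 2 statements merged into one kernel-verified Lean document; each statement's English description precedes it below -/
import Mathlib

section
/- Let f be a minmax monotone cost function on a finite tree T_in, 𝒯 ≥ 0, and T = (V,E) a working subtree with sink set S. Let w ∈ V, let η be a neighbor of w in T, and let T' = T_{-w}(η) = (V', E') be the component of T − w containing η. Suppose S ∩ V' = ∅ and f(V' ∪ {w}, w) ≤ 𝒯. Then no ordered pair (u', v') with u', v' ∈ V' ∪ {w}, (u',v') an edge of T, and V_{-v'}(u') ⊆ V', satisfies the peaking criterion. -/
open SimpleGraph Set
open scoped ENNReal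

variable {V : Type*}

/-- The vertex set of the connected component of the subgraph of `G` induced on `A`
containing the vertex `u` (empty if `u ∉ A`). -/
def reachSet (G : SimpleGraph V) (A : Set V) (u : V) : Set V :=
  {y | ∃ (hu : u ∈ A) (hy : y ∈ A), (G.induce A).Reachable ⟨u, hu⟩ ⟨y, hy⟩}

/-- `U` is a subtree: the induced subgraph on `U` is connected. -/
def IsSubtree (G : SimpleGraph V) (U : Set V) : Prop :=
  (G.induce U).Connected

/-- A minmax monotone cost function on the tree `G`:
`f {s} s = 0`; `f U s = ∞` if `U` is not a subtree or `s ∉ U`; set monotonicity;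
path monotonicity; and max tree composition (the slices of `U` defined by `s` being the
connected components of `U \ {s}`). -/
structure IsMinmaxMonotone (G : SimpleGraph V) (f : Set V → V → ℝ≥0∞) : Prop where
  singleton_eq_zero : ∀ s : V, f {s} s = 0
  eq_top_of_not_subtree : ∀ (U : Set V) (s : V), ¬ IsSubtree G U → f U s = ⊤
  eq_top_of_not_mem : ∀ (U : Set V) (s : V), s ∉ U → f U s = ⊤
  set_mono : ∀ (U₁ U₂ : Set V) (s : V), IsSubtree G U₁ → IsSubtree G U₂ →
    s ∈ U₁ → U₁ ⊆ U₂ → f U₁ s ≤ f U₂ s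
  path_mono : ∀ (U : Set V) (s u : V), IsSubtree G U → s ∉ U → u ∈ U → G.Adj s u →
    f U u ≤ f (U ∪ {s}) s
  max_comp : ∀ (U : Set V) (s : V), IsSubtree G U → s ∈ U →
    f U s = ⨆ x ∈ U \ {s}, f (reachSet G (U \ {s}) x ∪ {s}) s

/-- `s` is a leaf of the (working) tree induced on `W`. -/
def IsLeafOf (G : SimpleGraph V) (W : Set V) (s : V) : Prop :=
  s ∈ W ∧ ∃! u, u ∈ W ∧ G.Adj s u

/-- The ordered pair `(u,v)` satisfies the peaking criterion in the working tree on `W`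
with sink set `S` and threshold `𝒯`. -/
def PeakingPair (G : SimpleGraph V) (f : Set V → V → ℝ≥0∞) (𝒯 : ℝ≥0∞)
    (W S : Set V) (u v : V) : Prop :=
  u ∈ W ∧ v ∈ W ∧ G.Adj u v ∧ S ∩ reachSet G (W \ {v}) u = ∅ ∧
    f (reachSet G (W \ {v}) u) u ≤ 𝒯 ∧ 𝒯 < f (reachSet G (W \ {v}) u ∪ {v}) v

/-- `w` lies on the unique path from `a` to `b` in the tree induced on `W`. -/
def OnPath (G : SimpleGraph V) (W : Set V) (a b w : V) : Prop :=
  a ∈ W ∧ b ∈ W ∧ w ∈ W ∧ b ∉ reachSet G (W \ {w}) a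

/-- Vertices of the hub tree: union of the paths from the sinks to the root `r`. -/
def hubVerts (G : SimpleGraph V) (W S : Set V) (r : V) : Set V :=
  {w | ∃ s ∈ S, OnPath G W s r w}

/-- `r` is a valid root: a non-sink vertex of the working tree such that at least two of
the subtrees hanging off it contain sinks. -/
def GoodRoot (G : SimpleGraph V) (W S : Set V) (r : V) : Prop :=
  r ∈ W ∧ r ∉ S ∧
    ∃ η₁ η₂ : V, η₁ ≠ η₂ ∧ η₁ ∈ W ∧ η₂ ∈ W ∧ G.Adj r η₁ ∧ G.Adj r η₂ ∧
      (S ∩ reachSet G (W \ {r}) η₁).Nonempty ∧ (S ∩ reachSet G (W \ {r}) η₂).Nonempty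

/-- The working tree on `W` is RC-viable w.r.t. sinks `S` and root `r`: every outstanding
branch, together with the hub-tree node it is attached to, has cost at most `𝒯`. -/
def RCViable (G : SimpleGraph V) (f : Set V → V → ℝ≥0∞) (𝒯 : ℝ≥0∞)
    (W S : Set V) (r : V) : Prop :=
  ∀ w ∈ hubVerts G W S r, ∀ η ∈ W, G.Adj w η → η ∉ hubVerts G W S r →
    f (reachSet G (W \ {w}) η ∪ {w}) w ≤ 𝒯

/-- The set `A` is self-sufficient: it can be partitioned into subtree blocks, one for
each sink in `S ∩ A`, each block containing its sink and having cost at most `𝒯`. -/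
def SelfSufficient (G : SimpleGraph V) (f : Set V → V → ℝ≥0∞) (𝒯 : ℝ≥0∞)
    (S A : Set V) : Prop :=
  ∃ P : V → Set V,
    (⋃ s ∈ S ∩ A, P s) = A ∧
    (∀ s ∈ S ∩ A, IsSubtree G (P s) ∧ s ∈ P s ∧ f (P s) s ≤ 𝒯) ∧
    (S ∩ A).Pairwise fun s t => Disjoint (P s) (P t)

/-- The vertices of the path `Π(a,b)` in the tree induced on `W`. -/
def pathSet (G : SimpleGraph V) (W : Set V) (a b : V) : Set V :=
  {w | OnPath G W a b w}

/-- All vertices of outstanding branches attached to `w` (given hub-tree vertices `Hub`). -/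
def branchesAt (G : SimpleGraph V) (W Hub : Set V) (w : V) : Set V :=
  ⋃ η ∈ {η : V | η ∈ W ∧ G.Adj w η ∧ η ∉ Hub}, reachSet G (W \ {w}) η

/-- The bulk path `BP(a,b)`: the path `Π(a,b)` together with all outstanding branches
attached to its vertices. -/
def bulkPath (G : SimpleGraph V) (W S : Set V) (r a b : V) : Set V :=
  pathSet G W a b ∪ ⋃ w ∈ pathSet G W a b, branchesAt G W (hubVerts G W S r) w

/-- `v` is the parent of `u` in the hub tree rooted at `r`. -/
def HubParent (G : SimpleGraph V) (W S : Set V) (r u v : V) : Prop :=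
  u ∈ hubVerts G W S r ∧ v ∈ hubVerts G W S r ∧ G.Adj u v ∧ OnPath G W u r v

/-- The ordered pair `(u,v)` satisfies the reaching criterion: `v` is the hub-tree parent
of `u`, `T₋ᵥ(u)` is self-sufficient, and `BP(v,v) ∪ V₋ᵥ(u)` is not self-sufficient. -/
def ReachingPair (G : SimpleGraph V) (f : Set V → V → ℝ≥0∞) (𝒯 : ℝ≥0∞)
    (W S : Set V) (r u v : V) : Prop :=
  HubParent G W S r u v ∧
  SelfSufficient G f 𝒯 S (reachSet G (W \ {v}) u) ∧
  ¬ SelfSufficient G f 𝒯 S (bulkPath G W S r v v ∪ reachSet G (W \ {v}) u)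

/-- The vertex set `V(v)` of the subtree of the working tree (rooted at `r`) rooted at `v`:
all vertices whose path to the root passes through `v`. -/
def rootedBelow (G : SimpleGraph V) (W : Set V) (r v : V) : Set V :=
  {x | OnPath G W x r v}

/-- The rooted subtree `T(v)` is RC-viable: every outstanding branch attached to a
hub-tree node lying in `T(v)` has, together with its attachment node, cost at most `𝒯`. -/
def RCViableBelow (G : SimpleGraph V) (f : Set V → V → ℝ≥0∞) (𝒯 : ℝ≥0∞)
    (W S : Set V) (r v : V) : Prop :=
  ∀ w ∈ hubVerts G W S r ∩ rootedBelow G W r v, ∀ η ∈ W, G.Adj w η →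
    η ∉ hubVerts G W S r → f (reachSet G (W \ {w}) η ∪ {w}) w ≤ 𝒯

/-- The subtree with vertex set `A` (of the working tree rooted at `r`) is recursively
self-sufficient: for every hub-tree node `w` in `A`, the part of `A` lying below `w`
is self-sufficient. -/
def RecursivelySelfSufficientOn (G : SimpleGraph V) (f : Set V → V → ℝ≥0∞) (𝒯 : ℝ≥0∞)
    (W S : Set V) (r : V) (A : Set V) : Prop :=
  ∀ w ∈ hubVerts G W S r ∩ A, SelfSufficient G f 𝒯 S (rootedBelow G W r w ∩ A)

/-- A feasible sink configuration: a partition of all of `V_in` into subtree blocks,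
one per sink, each block containing exactly its own sink and having cost at most `𝒯`. -/
def IsFeasibleConfig (G : SimpleGraph V) (f : Set V → V → ℝ≥0∞) (𝒯 : ℝ≥0∞)
    (St : Set V) (P : V → Set V) : Prop :=
  (⋃ s ∈ St, P s) = Set.univ ∧
  St.Pairwise (fun s t => Disjoint (P s) (P t)) ∧
  ∀ s ∈ St, IsSubtree G (P s) ∧ St ∩ P s = {s} ∧ f (P s) s ≤ 𝒯

/-- An optimal feasible sink configuration: one with the minimum number of sinks. -/
def IsOptimalConfig (G : SimpleGraph V) (f : Set V → V → ℝ≥0∞) (𝒯 : ℝ≥0∞)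
    (St : Set V) (P : V → Set V) : Prop :=
  IsFeasibleConfig G f 𝒯 St P ∧
  ∀ (St' : Set V) (P' : V → Set V), IsFeasibleConfig G f 𝒯 St' P' → St.ncard ≤ St'.ncard

/-- A partial sink configuration relative to the working tree on `W`: pairwise disjoint
subtree blocks of cost at most `𝒯`, one per sink of `Sout`, covering `V_in \ (W \ Sout)`. -/
def IsPartialConfig (G : SimpleGraph V) (f : Set V → V → ℝ≥0∞) (𝒯 : ℝ≥0∞)
    (W : Set V) (Sout : Set V) (P : V → Set V) : Prop :=
  Sout.Pairwise (fun s t => Disjoint (P s) (P t)) ∧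
  (∀ s ∈ Sout, IsSubtree G (P s) ∧ s ∈ P s ∧ f (P s) s ≤ 𝒯) ∧
  (⋃ s ∈ Sout, P s) = Set.univ \ (W \ Sout)

/-- `(St, Pt)` is an optimal feasible sink configuration witnessing the optimality of the
partial configuration `(Sout, P)` relative to the working tree on `W` (conditions (C1)-(C3)). -/
def WitnessesOptimality (G : SimpleGraph V) (f : Set V → V → ℝ≥0∞) (𝒯 : ℝ≥0∞)
    (W : Set V) (Sout : Set V) (P : V → Set V) (St : Set V) (Pt : V → Set V) : Prop :=
  IsOptimalConfig G f 𝒯 St Pt ∧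
  Sout ⊆ St ∧
  St \ W = Sout \ W ∧
  (∀ s ∈ Sout ∩ W, IsLeafOf G W s) ∧
  (∀ s ∈ St, s ∉ W → Pt s = P s ∧ Pt s ∩ W = ∅) ∧
  (∀ s ∈ Sout ∩ W, P s ⊆ Pt s ∧ Pt s \ P s ⊆ W) ∧
  (∀ s ∈ St, s ∉ Sout → Pt s ⊆ W)

/-- The partial sink configuration `(Sout, P)` is optimal relative to the working tree on `W`. -/
def OptimalRelative (G : SimpleGraph V) (f : Set V → V → ℝ≥0∞) (𝒯 : ℝ≥0∞)
    (W : Set V) (Sout : Set V) (P : V → Set V) : Prop :=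
  ∃ (St : Set V) (Pt : V → Set V), WitnessesOptimality G f 𝒯 W Sout P St Pt

/-- A walk staying inside `A` and meeting a component of `A` ends in that component. -/
lemma end_mem_reachSet_of_walk {G : SimpleGraph V} {A : Set V} {u x w : V} (p : G.Walk x w)
    (hp : ∀ y ∈ p.support, y ∈ A) (hx : x ∈ reachSet G A u) : w ∈ reachSet G A u := by
  obtain ⟨hu, _, hr⟩ := hx
  exact ⟨hu, hp _ p.end_mem_support, hr.trans ⟨p.induce A hp⟩⟩

/-- Adding to a subtree a vertex adjacent to it yields a subtree. -/
lemma IsSubtree.union_singleton {G : SimpleGraph V} {B : Set V} {u v : V} (hB : IsSubtree G B)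
    (hv : v ∈ B) (h : G.Adj v u) : IsSubtree G (B ∪ {u}) :=
  connected_induce_union hB.preconnected Preconnected.of_subsingleton hv rfl h

/-- Any two vertices of a subtree are joined by a path inside it. -/
lemma IsSubtree.exists_isPath_subset {G : SimpleGraph V} {U : Set V} (hU : IsSubtree G U) {a b : V}
    (ha : a ∈ U) (hb : b ∈ U) : ∃ p : G.Walk a b, p.IsPath ∧ ∀ x ∈ p.support, x ∈ U := by
  obtain ⟨p, hp⟩ := hU.exists_isPath ⟨a, ha⟩ ⟨b, hb⟩
  let φ : G.induce U →g G := (Embedding.induce U).toHom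
  refine ⟨p.map φ, hp.map Subtype.val_injective, fun x hx => ?_⟩
  obtain ⟨y, -, rfl⟩ := List.mem_map.1 (p.support_map φ ▸ hx : x ∈ p.support.map φ)
  exact y.2

/-- Moving the sink of a subtree `B` along a path leaving `B`, while enlarging `B` to a subtree
containing that path, does not decrease the cost. -/
lemma IsMinmaxMonotone.le_of_isPath {G : SimpleGraph V} {f : Set V → V → ℝ≥0∞}
    (hf : IsMinmaxMonotone G f) {U : Set V} (hU : IsSubtree G U) {v w : V} (p : G.Walk v w)
    (hp : p.IsPath) (hpU : ∀ x ∈ p.support, x ∈ U) (B : Set V) (hB : IsSubtree G B)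
    (hBU : B ⊆ U) (hvB : v ∈ B) (hBp : ∀ x ∈ p.support, x ∈ B → x = v) : f B v ≤ f U w := by
  induction p generalizing B with
  | nil => exact hf.set_mono B U _ hB hU hvB hBU
  | @cons v u w h q ih =>
    rw [Walk.cons_isPath_iff] at hp
    simp only [Walk.support_cons, List.mem_cons, forall_eq_or_imp] at hpU hBp
    have hmem : u ∉ B := fun hu => h.ne (hBp.2 u q.start_mem_support hu).symm
    refine (hf.path_mono B u v hB hmem hvB h.symm).trans
      (ih hp.1 hpU.2 _ (hB.union_singleton hvB h)
        (union_subset hBU (singleton_subset_iff.2 (hpU.2 u q.start_mem_support))) (Or.inr rfl) ?_)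
    rintro x hx (hxB | hxu)
    · exact absurd (hBp.2 x hx hxB ▸ hx) hp.2
    · exact hxu

/-- if the branch `T' = T₋w(η)` contains no sink and
`f(V' ∪ {w}, w) ≤ 𝒯`, then no directed edge `(u',v')` lying inside `V' ∪ {w}` (i.e. with
`V₋ᵥ'(u') ⊆ V'`) satisfies the peaking criterion. -/
theorem statement_14 [Fintype V] (G : SimpleGraph V) (hG : G.IsTree)
    (f : Set V → V → ℝ≥0∞) (hf : IsMinmaxMonotone G f) (𝒯 : ℝ≥0∞)
    (W S : Set V) (hW : IsSubtree G W) (hSW : S ⊆ W)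
    (hSleaf : ∀ s ∈ S, IsLeafOf G W s)
    (w η : V) (hw : w ∈ W) (hη : η ∈ W) (hadj : G.Adj w η)
    (hnosink : S ∩ reachSet G (W \ {w}) η = ∅)
    (hcost : f (reachSet G (W \ {w}) η ∪ {w}) w ≤ 𝒯) :
    ∀ u' v' : V, u' ∈ reachSet G (W \ {w}) η ∪ {w} → v' ∈ reachSet G (W \ {w}) η ∪ {w} →
      G.Adj u' v' → reachSet G (W \ {v'}) u' ⊆ reachSet G (W \ {w}) η →
      ¬ PeakingPair G f 𝒯 W S u' v' := by
  classical
  rintro u' v' - hv' huv hsub ⟨hu'W, -, -, -, hA, hpeak⟩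
  have hlt : 𝒯 < ⊤ := hpeak.trans_le le_top
  have hU : IsSubtree G (reachSet G (W \ {w}) η ∪ {w}) := by
    by_contra h
    rw [hf.eq_top_of_not_subtree _ _ h] at hcost
    exact absurd hlt hcost.not_gt
  have hAtree : IsSubtree G (reachSet G (W \ {v'}) u') := by
    by_contra h
    rw [hf.eq_top_of_not_subtree _ _ h] at hA
    exact absurd hlt hA.not_gt
  have hu'A : u' ∈ reachSet G (W \ {v'}) u' := ⟨⟨hu'W, huv.ne⟩, ⟨hu'W, huv.ne⟩, Reachable.refl _⟩
  have hUW : reachSet G (W \ {w}) η ∪ {w} ⊆ W :=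
    union_subset (fun _ hy => hy.2.1.1) (singleton_subset_iff.2 hw)
  have hwA : w ∉ reachSet G (W \ {v'}) u' := fun h => (hsub h).2.1.2 rfl
  obtain ⟨p, hp, hpU⟩ := hU.exists_isPath_subset hv' (Or.inr rfl)
  refine hpeak.not_ge ((hf.le_of_isPath hU p hp hpU _ (hAtree.union_singleton hu'A huv)
    (union_subset (hsub.trans subset_union_left) (singleton_subset_iff.2 hv')) (Or.inr rfl)
    ?_).trans hcost)
  rintro x hx (hxA | hxv)
  · cases p with
    | nil => simp_all
    | cons h q =>
      rw [Walk.cons_isPath_iff] at hp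
      rw [Walk.support_cons, List.mem_cons] at hx
      refine hx.resolve_right fun hxq => hwA (end_mem_reachSet_of_walk (q.dropUntil x hxq)
        (fun y hy => ?_) hxA)
      have hyq := q.support_dropUntil_subset_support hxq hy
      exact ⟨hUW (hpU y (List.mem_cons_of_mem _ hyq)), fun hyv => hp.2 (hyv ▸ hyq)⟩
  · exact hxv
end

section
/- Let T_in = (V_in, E_in) be a finite tree with vertex weights w_v ≥ 0 and strictly positive edge lengths, let d be the path-length distance, let W(U) = Σ_{u ∈ U} w_u, and fix a capacity W > 0. Define f : 2^{V_in} × V_in → [0,∞] by: f(U,s) = ∞ if U is not a subtree or s ∉ U; f({s},s) = 0; and for a subtree P containing s with slices U₁,…,U_t (the components of P \ {s}), f(P,s) = max_i g(U_i, s) where g(U_i, s) = max_{u ∈ U_i} w_u · d(s,u) if W(U_i) ≤ W and g(U_i, s) = ∞ otherwise. Then f is a minmax monotone cost function: it satisfies set monotonicity, path monotonicity, and max tree composition. -/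
open SimpleGraph Set
open scoped ENNReal

variable {V : Type*}

/-- The path-length distance between `u` and `v`: the infimum over all walks of the total
edge length (in a tree with positive edge lengths this is the length of the unique path). -/
noncomputable def treeDist (G : SimpleGraph V) (len : Sym2 V → NNReal) (u v : V) : ℝ≥0∞ :=
  ⨅ p : G.Walk u v, ((p.edges.map len).sum : ℝ≥0∞)

open Classical in
/-- The weight-constrained weighted `k`-center cost function: for a subtree `P ∋ s` with
slices `U₁,…,U_t` (the components of `P \ {s}`), the cost is `max_i g(U_i, s)` where
`g(U_i,s) = max_{u ∈ U_i} w_u · d(s,u)` if `W(U_i) ≤ Wcap` and `∞` otherwise. -/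
noncomputable def fWCapacity (G : SimpleGraph V) (w : V → NNReal) (len : Sym2 V → NNReal)
    (Wcap : NNReal) (U : Set V) (s : V) : ℝ≥0∞ :=
  if IsSubtree G U ∧ s ∈ U then
    ⨆ x ∈ U \ {s},
      (if (∑' y : reachSet G (U \ {s}) x, (w (y : V) : ℝ≥0∞)) ≤ (Wcap : ℝ≥0∞) then
        ⨆ u ∈ reachSet G (U \ {s}) x, (w u : ℝ≥0∞) * treeDist G len s u
      else ⊤)
  else ⊤

lemma reachSet_subset (G : SimpleGraph V) (A : Set V) (x : V) : reachSet G A x ⊆ A :=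
  fun _ h => h.2.1

lemma mem_reachSet_self (G : SimpleGraph V) {A : Set V} {x : V} (hx : x ∈ A) :
    x ∈ reachSet G A x :=
  ⟨hx, hx, Reachable.refl _⟩

lemma reachSet_mono (G : SimpleGraph V) {A B : Set V} (h : A ⊆ B) (x : V) :
    reachSet G A x ⊆ reachSet G B x :=
  fun _ ⟨hx, hy, hxy⟩ => ⟨h hx, h hy, hxy.map (G.induceHomOfLE h).toHom⟩

lemma mem_reachSet_of_adj {G : SimpleGraph V} {A : Set V} {x a c : V}
    (ha : a ∈ reachSet G A x) (hc : c ∈ A) (h : G.Adj a c) : c ∈ reachSet G A x := by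
  obtain ⟨hx, haA, hr⟩ := ha
  exact ⟨hx, hc, hr.trans (Adj.reachable (G := G.induce A) (u := ⟨a, haA⟩) (v := ⟨c, hc⟩) h)⟩

/-- Walks in `A` starting in a component of `A` stay inside that component. -/
lemma reachable_induce_reachSet {G : SimpleGraph V} {A : Set V} {x : V} {a b : A}
    (p : (G.induce A).Walk a b) (ha : (a : V) ∈ reachSet G A x) :
    ∃ hb : (b : V) ∈ reachSet G A x,
      (G.induce (reachSet G A x)).Reachable ⟨a, ha⟩ ⟨b, hb⟩ := by
  induction p with
  | nil => exact ⟨ha, Reachable.refl _⟩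
  | @cons a c b h p ih =>
    have hc : (c : V) ∈ reachSet G A x := mem_reachSet_of_adj ha c.2 h
    obtain ⟨hb, hr⟩ := ih hc
    exact ⟨hb, (Adj.reachable (G := G.induce (reachSet G A x))
      (u := ⟨a, ha⟩) (v := ⟨c, hc⟩) h).trans hr⟩

lemma isSubtree_reachSet (G : SimpleGraph V) {A : Set V} {x : V} (hx : x ∈ A) :
    IsSubtree G (reachSet G A x) := by
  refine (connected_iff_exists_forall_reachable _).2 ⟨⟨x, mem_reachSet_self G hx⟩, ?_⟩
  rintro ⟨y, hy⟩
  obtain ⟨_, _, ⟨p⟩⟩ := id hy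
  exact (reachable_induce_reachSet p (mem_reachSet_self G hx)).2

lemma IsSubtree.reachSet_eq {G : SimpleGraph V} {A : Set V} (hA : IsSubtree G A) {x : V}
    (hx : x ∈ A) : reachSet G A x = A :=
  (reachSet_subset G A x).antisymm fun y hy => ⟨hx, hy, hA.preconnected _ ⟨y, hy⟩⟩

/-- A walk in `U` ending at `s` enters `s` from the slice in which it starts. -/
lemma exists_adj_of_walk {G : SimpleGraph V} {U : Set V} {x : V} {a s : U}
    (p : (G.induce U).Walk a s) (ha : (a : V) ∈ reachSet G (U \ {(s : V)}) x) :
    ∃ y ∈ reachSet G (U \ {(s : V)}) x, G.Adj y s := by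
  induction p with
  | nil => exact absurd rfl (reachSet_subset _ _ _ ha).2
  | @cons a c s h p ih =>
    by_cases hcs : (c : V) = s
    · exact ⟨a, ha, hcs ▸ h⟩
    · exact ih (mem_reachSet_of_adj ha ⟨c.2, hcs⟩ h)

lemma IsSubtree.reachSet_union_singleton {G : SimpleGraph V} {U : Set V} (hU : IsSubtree G U)
    {s x : V} (hs : s ∈ U) (hx : x ∈ U \ {s}) :
    IsSubtree G (reachSet G (U \ {s}) x ∪ {s}) := by
  obtain ⟨p⟩ := hU.preconnected ⟨x, hx.1⟩ ⟨s, hs⟩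
  obtain ⟨y, hy, hadj⟩ := exists_adj_of_walk p (mem_reachSet_self G hx)
  have h := induce_union_connected (isSubtree_reachSet G hx).preconnected
    (induce_pair_connected_of_adj hadj).preconnected ⟨y, hy, by simp⟩
  rwa [union_insert, insert_eq_of_mem (mem_union_left _ hy)] at h

lemma isSubtree_singleton (G : SimpleGraph V) (s : V) : IsSubtree G {s} :=
  (connected_iff_exists_forall_reachable _).2
    ⟨⟨s, rfl⟩, fun ⟨_, hy⟩ => by cases hy; exact Reachable.refl _⟩

/-- In an acyclic graph, if `s` is adjacent to a vertex `u` of a subtree avoiding `s`, then the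
vertices of the subtree are at least as far from `s` as from `u`. -/
lemma treeDist_le_of_adj {G : SimpleGraph V} (hG : G.IsAcyclic) (len : Sym2 V → NNReal)
    {U : Set V} {s u v : V} (hU : IsSubtree G U) (hs : s ∉ U) (hu : u ∈ U) (hv : v ∈ U)
    (h : G.Adj s u) : treeDist G len u v ≤ treeDist G len s v := by
  classical
  refine le_iInf fun p => ?_
  obtain ⟨q⟩ := hU.preconnected ⟨u, hu⟩ ⟨v, hv⟩
  let q' : G.Walk u v := q.map (Embedding.induce U).toHom
  have hsq : s ∉ q'.bypass.support := by
    intro hmem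
    have hmap : q'.support = q.support.map (Embedding.induce U).toHom := Walk.support_map _ _
    obtain ⟨z, -, rfl⟩ := List.mem_map.1 (hmap ▸ q'.support_bypass_subset_support hmem)
    exact hs z.2
  have hpath : (Walk.cons h q'.bypass).IsPath := (q'.bypass_isPath).cons hsq
  have heq : p.bypass = Walk.cons h q'.bypass :=
    congrArg Subtype.val
      ((hG.subsingleton_path s v).elim ⟨_, p.bypass_isPath⟩ ⟨_, hpath⟩)
  have hsub : q'.bypass.edges.Sublist p.edges := by
    refine List.Sublist.trans ?_ p.edges_bypass_sublist_edges
    rw [heq, Walk.edges_cons]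
    exact List.sublist_cons_self _ _
  refine (iInf_le _ q'.bypass).trans ?_
  exact ENNReal.coe_le_coe.2 ((hsub.map len).sum_le_sum fun _ _ => zero_le)

open Classical in
/-- The cost `g(A, s)` of serving the slice `A` from `s`. -/
noncomputable def sliceCost (G : SimpleGraph V) (w : V → NNReal) (len : Sym2 V → NNReal)
    (Wcap : NNReal) (A : Set V) (s : V) : ℝ≥0∞ :=
  if (∑' y : A, (w (y : V) : ℝ≥0∞)) ≤ (Wcap : ℝ≥0∞) then
    ⨆ u ∈ A, (w u : ℝ≥0∞) * treeDist G len s u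
  else ⊤

lemma sliceCost_le_sliceCost (G : SimpleGraph V) (w : V → NNReal) (len : Sym2 V → NNReal)
    (Wcap : NNReal) {A B : Set V} {s t : V} (hAB : A ⊆ B)
    (hd : ∀ u ∈ A, treeDist G len s u ≤ treeDist G len t u) :
    sliceCost G w len Wcap A s ≤ sliceCost G w len Wcap B t := by
  unfold sliceCost
  by_cases hB : (∑' y : B, (w (y : V) : ℝ≥0∞)) ≤ (Wcap : ℝ≥0∞)
  · rw [if_pos hB,
      if_pos ((ENNReal.tsum_mono_subtype (fun y => (w y : ℝ≥0∞)) hAB).trans hB)]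
    refine iSup₂_le fun u hu => ?_
    exact (mul_le_mul_right (hd u hu) _).trans
      (le_iSup₂ (f := fun u (_ : u ∈ B) => (w u : ℝ≥0∞) * treeDist G len t u) u (hAB hu))
  · rw [if_neg hB]
    exact le_top

lemma fWCapacity_eq_iSup_sliceCost (G : SimpleGraph V) (w : V → NNReal) (len : Sym2 V → NNReal)
    (Wcap : NNReal) {U : Set V} {s : V} (hU : IsSubtree G U) (hs : s ∈ U) :
    fWCapacity G w len Wcap U s =
      ⨆ x ∈ U \ {s}, sliceCost G w len Wcap (reachSet G (U \ {s}) x) s :=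
  if_pos ⟨hU, hs⟩

/-- The cost of a single slice together with the sink is the cost of that slice. -/
lemma fWCapacity_union_singleton (G : SimpleGraph V) (w : V → NNReal) (len : Sym2 V → NNReal)
    (Wcap : NNReal) {A : Set V} {s : V} (hA : IsSubtree G A) (hs : s ∉ A)
    (hAs : IsSubtree G (A ∪ {s})) :
    fWCapacity G w len Wcap (A ∪ {s}) s = sliceCost G w len Wcap A s := by
  rw [fWCapacity_eq_iSup_sliceCost G w len Wcap hAs (Or.inr rfl)]
  have hdiff : (A ∪ {s}) \ {s} = A := by
    rw [union_singleton, insert_sdiff_of_mem _ (mem_singleton s), sdiff_singleton_eq_self hs]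
  obtain ⟨a, ha⟩ := hA.nonempty
  rw [hdiff]
  refine le_antisymm (iSup₂_le fun x hx => (by rw [hA.reachSet_eq hx])) ?_
  refine le_iSup₂_of_le a ha ?_
  rw [hA.reachSet_eq ha]

/-- the weight-constrained weighted `k`-center cost function on a finite tree
with nonnegative vertex weights, strictly positive edge lengths and positive capacity
`Wcap` is a minmax monotone cost function. -/
theorem statement_16 [Fintype V] (G : SimpleGraph V) (hG : G.IsTree)
    (w : V → NNReal) (len : Sym2 V → NNReal)
    (hlen : ∀ e ∈ G.edgeSet, 0 < len e)
    (Wcap : NNReal) (hWcap : 0 < Wcap) :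
    IsMinmaxMonotone G (fWCapacity G w len Wcap) := by
  refine ⟨fun s => ?_, fun U s h => if_neg fun h' => h h'.1, fun U s h => if_neg fun h' => h h'.2,
    fun U₁ U₂ s h₁ h₂ hs h => ?_, fun U s u hU hs hu hadj => ?_, fun U s hU hs => ?_⟩
  · rw [fWCapacity_eq_iSup_sliceCost G w len Wcap (isSubtree_singleton G s) rfl]
    simp
  · rw [fWCapacity_eq_iSup_sliceCost G w len Wcap h₁ hs,
      fWCapacity_eq_iSup_sliceCost G w len Wcap h₂ (h hs)]
    have hdiff : U₁ \ {s} ⊆ U₂ \ {s} := sdiff_subset_sdiff_left h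
    exact iSup₂_le fun x hx => le_iSup₂_of_le x (hdiff hx)
      (sliceCost_le_sliceCost G w len Wcap (reachSet_mono G hdiff x) fun _ _ => le_rfl)
  · have hUs : IsSubtree G (U ∪ {s}) := by
      have h := induce_union_connected hU.preconnected
        (induce_pair_connected_of_adj hadj.symm).preconnected ⟨u, hu, by simp⟩
      rwa [union_insert, insert_eq_of_mem (mem_union_left _ hu)] at h
    rw [fWCapacity_union_singleton G w len Wcap hU hs hUs,
      fWCapacity_eq_iSup_sliceCost G w len Wcap hU hu]
    have hslice (x : V) : reachSet G (U \ {u}) x ⊆ U :=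
      (reachSet_subset G _ x).trans sdiff_subset
    exact iSup₂_le fun x _ => sliceCost_le_sliceCost G w len Wcap (hslice x) fun v hv =>
      treeDist_le_of_adj hG.isAcyclic len hU hs hu (hslice x hv) hadj
  · rw [fWCapacity_eq_iSup_sliceCost G w len Wcap hU hs]
    exact biSup_congr fun x hx => (fWCapacity_union_singleton G w len Wcap
      (isSubtree_reachSet G hx) (fun h => (reachSet_subset _ _ _ h).2 rfl) (hU.reachSet_union_singleton hs hx)).symm
end
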